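/- Consider a ferromagnetic Ising model on {±1}^d whose graph G has maximum degree at most s and all edge interactions in [0, Θ], with (s−1)·tanh(Θ) < 1. Then for any two non-adjacent vertices k and ℓ, E[X_k·X_ℓ] ≤ s·tanh²(Θ)/(1 − (s−1)·tanh(Θ)). -/

import Mathlib

open scoped Classical

/-- The spin value of a Boolean configuration entry. -/
def spin (b : Bool) : ℝ := if b then 1 else -1

/-- Energy of a zero-field ferromagnetic Ising model with interaction weights `J`
(summed over ordered pairs `p.1 < p.2`). -/
noncomputable def weightedEnergy (d : ℕ) (J : Fin d → Fin d → ℝ) (x : Fin d → Bool) : ℝ :=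
  ∑ p ∈ Finset.univ.filter (fun p : Fin d × Fin d => p.1 < p.2),
    J p.1 p.2 * spin (x p.1) * spin (x p.2)

section Ising

variable {V : Type*}

/-- The product of the spins at the two ends of an edge. -/
noncomputable def edgeSpin (x : V → Bool) (e : Sym2 V) : ℝ :=
  Sym2.lift ⟨fun u w => spin (x u) * spin (x w), fun _ _ => mul_comm _ _⟩ e

@[simp]
lemma edgeSpin_mk (x : V → Bool) (u w : V) :
    edgeSpin x s(u, w) = spin (x u) * spin (x w) := rfl

lemma spin_mul_self (b : Bool) : spin b * spin b = 1 := by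
  cases b <;> simp [spin]

lemma spin_not (b : Bool) : spin (!b) = -spin b := by
  cases b <;> simp [spin]

/-- The Gibbs weight of a configuration with edge set `S` and interactions `J`. -/
noncomputable def gibbsWeight (J : Sym2 V → ℝ) (S : Finset (Sym2 V)) (x : V → Bool) : ℝ :=
  Real.exp (∑ e ∈ S, J e * edgeSpin x e)

lemma edgeSpin_eq_one_or (x : V → Bool) (e : Sym2 V) : edgeSpin x e = 1 ∨ edgeSpin x e = -1 := by
  induction e with
  | _ u w => cases hu : x u <;> cases hw : x w <;> simp [spin, hu, hw]

variable [DecidableEq V]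

lemma gibbsWeight_insert (J : Sym2 V → ℝ) {S : Finset (Sym2 V)} {e : Sym2 V} (he : e ∉ S)
    (x : V → Bool) :
    gibbsWeight J (insert e S) x =
      Real.cosh (J e) * ((1 + Real.tanh (J e) * edgeSpin x e) * gibbsWeight J S x) := by
  have hc : Real.cosh (J e) ≠ 0 := (Real.cosh_pos _).ne'
  have hexp : Real.exp (J e * edgeSpin x e) =
      Real.cosh (J e) * (1 + Real.tanh (J e) * edgeSpin x e) := by
    rw [Real.tanh_eq_sinh_div_cosh, mul_add, mul_one, ← mul_assoc, mul_div_cancel₀ _ hc]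
    rcases edgeSpin_eq_one_or x e with h | h
    · rw [h, mul_one, mul_one, Real.cosh_add_sinh]
    · rw [h, mul_neg_one, mul_neg_one, ← sub_eq_add_neg, Real.cosh_sub_sinh]
  rw [gibbsWeight, Finset.sum_insert he, Real.exp_add, hexp, gibbsWeight, mul_assoc]

lemma tanh_nonneg {a : ℝ} (ha : 0 ≤ a) : 0 ≤ Real.tanh a := by
  rw [Real.tanh_eq_sinh_div_cosh]
  exact div_nonneg (Real.sinh_nonneg_iff.2 ha) (Real.cosh_pos _).le

lemma tanh_le_tanh {a b : ℝ} (hab : a ≤ b) : Real.tanh a ≤ Real.tanh b := by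
  have h : 0 ≤ Real.sinh (b - a) := Real.sinh_nonneg_iff.2 (sub_nonneg.2 hab)
  rw [Real.sinh_sub] at h
  rw [Real.tanh_eq_sinh_div_cosh, Real.tanh_eq_sinh_div_cosh,
    div_le_div_iff₀ (Real.cosh_pos _) (Real.cosh_pos _)]
  linarith

variable [Fintype V]

lemma prod_spin_pow_single (x : V → Bool) (a : V) :
    ∏ i, spin (x i) ^ (Pi.single a 1 : V → ℕ) i = spin (x a) := by
  rw [Finset.prod_eq_single a (by intro b _ hb; simp [hb]) (by simp)]
  simp

/-- The first Griffiths inequality. -/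
lemma griffiths_nonneg {J : Sym2 V → ℝ} (hJ : ∀ e, 0 ≤ J e) (S : Finset (Sym2 V)) (A : V → ℕ) :
    0 ≤ ∑ x : V → Bool, (∏ i, spin (x i) ^ A i) * gibbsWeight J S x := by
  induction S using Finset.induction_on generalizing A with
  | empty =>
    have h : ∑ x : V → Bool, ∏ i, spin (x i) ^ A i = ∏ i, ∑ b : Bool, spin b ^ A i := by
      rw [Finset.prod_univ_sum, Fintype.piFinset_univ]
    simp only [gibbsWeight, Finset.sum_empty, Real.exp_zero, mul_one, h]
    refine Finset.prod_nonneg fun i _ => ?_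
    rcases neg_one_pow_eq_or ℝ (A i) with h | h <;> simp [spin, h]
  | insert e S he ih =>
    induction e with
    | _ u w =>
      have h : ∑ x : V → Bool, (∏ i, spin (x i) ^ A i) * gibbsWeight J (insert s(u, w) S) x =
          Real.cosh (J s(u, w)) *
            (∑ x : V → Bool, (∏ i, spin (x i) ^ A i) * gibbsWeight J S x +
              Real.tanh (J s(u, w)) * ∑ x : V → Bool,
                (∏ i, spin (x i) ^ (A + Pi.single u 1 + Pi.single w 1 : V → ℕ) i) *
                  gibbsWeight J S x) := by
        rw [Finset.mul_sum, ← Finset.sum_add_distrib, Finset.mul_sum]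
        refine Finset.sum_congr rfl fun x _ => ?_
        simp only [Pi.add_apply, pow_add, Finset.prod_mul_distrib, prod_spin_pow_single]
        rw [gibbsWeight_insert J he, edgeSpin_mk]
        ring
      rw [h]
      exact mul_nonneg (Real.cosh_pos _).le
        (add_nonneg (ih A) (mul_nonneg (tanh_nonneg (hJ _)) (ih _)))

/-- The partition function. -/
noncomputable def partitionSum (J : Sym2 V → ℝ) (S : Finset (Sym2 V)) : ℝ :=
  ∑ x : V → Bool, gibbsWeight J S x

/-- The unnormalized two-point correlation. -/
noncomputable def corrSum (J : Sym2 V → ℝ) (S : Finset (Sym2 V)) (u w : V) : ℝ :=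
  ∑ x : V → Bool, spin (x u) * spin (x w) * gibbsWeight J S x

lemma partitionSum_pos (J : Sym2 V → ℝ) (S : Finset (Sym2 V)) : 0 < partitionSum J S :=
  Finset.sum_pos (fun _ _ => Real.exp_pos _) Finset.univ_nonempty

lemma corrSum_self (J : Sym2 V → ℝ) (S : Finset (Sym2 V)) (u : V) :
    corrSum J S u u = partitionSum J S := by
  simp only [corrSum, partitionSum, spin_mul_self, one_mul]

lemma corrSum_nonneg {J : Sym2 V → ℝ} (hJ : ∀ e, 0 ≤ J e) (S : Finset (Sym2 V)) (u w : V) :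
    0 ≤ corrSum J S u w := by
  convert griffiths_nonneg hJ S (Pi.single u 1 + Pi.single w 1) using 1
  refine Finset.sum_congr rfl fun x _ => ?_
  simp only [Pi.add_apply, pow_add, Finset.prod_mul_distrib, prod_spin_pow_single]

lemma partitionSum_insert (J : Sym2 V → ℝ) {S : Finset (Sym2 V)} {v w : V} (he : s(v, w) ∉ S) :
    partitionSum J (insert s(v, w) S) = Real.cosh (J s(v, w)) *
      (partitionSum J S + Real.tanh (J s(v, w)) * corrSum J S v w) := by
  simp only [partitionSum, corrSum]
  rw [Finset.mul_sum, ← Finset.sum_add_distrib, Finset.mul_sum]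
  refine Finset.sum_congr rfl fun x _ => ?_
  rw [gibbsWeight_insert J he, edgeSpin_mk]
  ring

lemma corrSum_insert (J : Sym2 V → ℝ) {S : Finset (Sym2 V)} {v w : V} (he : s(v, w) ∉ S) (l : V) :
    corrSum J (insert s(v, w) S) v l = Real.cosh (J s(v, w)) *
      (corrSum J S v l + Real.tanh (J s(v, w)) * corrSum J S w l) := by
  simp only [corrSum]
  rw [Finset.mul_sum, ← Finset.sum_add_distrib, Finset.mul_sum]
  refine Finset.sum_congr rfl fun x _ => ?_
  rw [gibbsWeight_insert J he, edgeSpin_mk]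
  linear_combination Real.cosh (J s(v, w)) * Real.tanh (J s(v, w)) * spin (x w) * spin (x l) *
    gibbsWeight J S x * spin_mul_self (x v)

/-- An isolated vertex is uncorrelated with every other one. -/
lemma corrSum_eq_zero (J : Sym2 V → ℝ) {S : Finset (Sym2 V)} {v l : V} (hv : ∀ e ∈ S, v ∉ e)
    (hvl : v ≠ l) : corrSum J S v l = 0 := by
  let flip : (V → Bool) → V → Bool := fun x => Function.update x v (!x v)
  have hflip : Function.Involutive flip := fun x => by simp [flip]
  have hw : ∀ x, gibbsWeight J S (flip x) = gibbsWeight J S x := by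
    intro x
    simp only [gibbsWeight]
    congr 1
    refine Finset.sum_congr rfl fun e he => ?_
    have hve := hv e he
    induction e with
    | _ a b =>
      rw [Sym2.mem_iff, not_or] at hve
      simp [flip, Function.update_of_ne (Ne.symm hve.1), Function.update_of_ne (Ne.symm hve.2)]
  have h : corrSum J S v l = -corrSum J S v l := by
    conv_lhs => rw [corrSum, ← Equiv.sum_comp hflip.toPerm]
    rw [corrSum, ← Finset.sum_neg_distrib]
    refine Finset.sum_congr rfl fun x _ => ?_
    have h1 : flip x v = !x v := by simp [flip]
    have h2 : flip x l = x l := by simp [flip, hvl.symm]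
    rw [Function.Involutive.coe_toPerm, hw, h1, h2, spin_not]
    ring
  linarith

/-- If `v` is joined to `w`, removing the edge bounds the correlation of `v` with `l` by one step
of a walk. -/
lemma corrSum_insert_le {J : Sym2 V → ℝ} (hJ : ∀ e, 0 ≤ J e) {S : Finset (Sym2 V)} {v w l : V}
    (he : s(v, w) ∉ S) {t a b : ℝ} (ht : Real.tanh (J s(v, w)) ≤ t) (ha : 0 ≤ a) (hb : 0 ≤ b)
    (hv : corrSum J S v l ≤ a * partitionSum J S) (hw : corrSum J S w l ≤ b * partitionSum J S) :
    corrSum J (insert s(v, w) S) v l ≤ (a + t * b) * partitionSum J (insert s(v, w) S) := by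
  have h0 : 0 ≤ Real.tanh (J s(v, w)) := tanh_nonneg (hJ _)
  have hZ := (partitionSum_pos J S).le
  have hab : 0 ≤ a + t * b := add_nonneg ha (mul_nonneg (h0.trans ht) hb)
  rw [corrSum_insert J he, partitionSum_insert J he, mul_left_comm]
  refine mul_le_mul_of_nonneg_left ?_ (Real.cosh_pos _).le
  calc _ ≤ a * partitionSum J S + t * (b * partitionSum J S) :=
        add_le_add hv <| (mul_le_mul_of_nonneg_left hw h0).trans <|
          mul_le_mul_of_nonneg_right ht (mul_nonneg hb hZ)
    _ = (a + t * b) * partitionSum J S := by ring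
    _ ≤ _ := mul_le_mul_of_nonneg_left
        (le_add_of_nonneg_right (mul_nonneg h0 (corrSum_nonneg hJ S v w))) hab

/-- The number of edges of `S` at `v` other than a possible edge from `v` to `l`. -/
noncomputable def degAvoid (S : Finset (Sym2 V)) (l v : V) : ℕ :=
  (S.filter fun e => v ∈ e ∧ e ≠ s(v, l)).card

/-- In a graph of maximum degree at most `s`, a vertex `v ≠ l` has correlation with `l` at most `t`
for the edge to `l`, if present, plus `t * B` for every other edge, where `B = t + (s - 1) t B`. -/
lemma corrSum_le {J : Sym2 V → ℝ} (hJ : ∀ e, 0 ≤ J e) {t B : ℝ} (ht : ∀ e, Real.tanh (J e) ≤ t)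
    (ht0 : 0 ≤ t) (hB : 0 ≤ B) {s : ℕ} (hrec : t + ((s : ℝ) - 1) * (t * B) = B)
    (S : Finset (Sym2 V))
    (hdeg : ∀ v, (S.filter fun e => v ∈ e).card ≤ s) {v l : V} (hvl : v ≠ l) :
    corrSum J S v l ≤
      ((if s(v, l) ∈ S then t else 0) + degAvoid S l v * (t * B)) * partitionSum J S := by
  have htB := mul_nonneg ht0 hB
  induction hn : S.card generalizing S v with
  | zero =>
    rw [Finset.card_eq_zero] at hn
    subst hn
    rw [corrSum_eq_zero J (by simp) hvl]
    simp [degAvoid]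
  | succ n ih =>
    by_cases hv : ∀ e ∈ S, v ∉ e
    · rw [corrSum_eq_zero J hv hvl]
      refine mul_nonneg (add_nonneg ?_ (mul_nonneg (Nat.cast_nonneg _) htB))
        (partitionSum_pos J S).le
      split_ifs <;> simp [ht0]
    push Not at hv
    obtain ⟨e, heS, hve⟩ := hv
    obtain ⟨w, rfl⟩ := Sym2.mem_iff_exists.1 hve
    obtain ⟨S, he, rfl⟩ : ∃ S', s(v, w) ∉ S' ∧ insert s(v, w) S' = S :=
      ⟨S.erase s(v, w), Finset.notMem_erase _ _, Finset.insert_erase heS⟩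
    have hcard : S.card = n := by
      rw [Finset.card_insert_of_notMem he] at hn
      omega
    have hdeg' : ∀ u, (S.filter fun e => u ∈ e).card ≤ s := fun u =>
      (Finset.card_le_card (Finset.filter_subset_filter _ (Finset.subset_insert _ _))).trans
        (hdeg u)
    have hnn : ∀ u, 0 ≤ (if s(u, l) ∈ S then t else 0) + degAvoid S l u * (t * B) := fun u =>
      add_nonneg (by split_ifs <;> simp [ht0]) (mul_nonneg (Nat.cast_nonneg _) htB)
    have hv := ih S hdeg' hvl hcard
    by_cases hwl : w = l
    · subst hwl
      have hstep := corrSum_insert_le hJ he (ht _) (hnn v) zero_le_one hv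
        (by rw [corrSum_self, one_mul])
      have hd : degAvoid (insert s(v, w) S) w v = degAvoid S w v := by
        rw [degAvoid, degAvoid, Finset.filter_insert, if_neg (by simp)]
      rw [hd, if_pos (Finset.mem_insert_self _ _)]
      rw [if_neg he] at hstep
      convert hstep using 2
      ring
    · have hw : corrSum J S w l ≤ B * partitionSum J S := by
        refine (ih S hdeg' hwl hcard).trans
          (mul_le_mul_of_nonneg_right ?_ (partitionSum_pos J S).le)
        have hdw : degAvoid S l w + 1 ≤ s := by
          refine le_trans ?_ (hdeg w)
          rw [Finset.filter_insert, if_pos (Sym2.mem_mk_right v w),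
            Finset.card_insert_of_notMem (by simp [he])]
          exact Nat.succ_le_succ
            (Finset.card_le_card (Finset.monotone_filter_right _ fun _ _ h => h.1))
        have hdw' : (degAvoid S l w : ℝ) ≤ (s : ℝ) - 1 := by
          have : (degAvoid S l w : ℝ) + 1 ≤ s := by exact_mod_cast hdw
          linarith
        calc _ ≤ t + ((s : ℝ) - 1) * (t * B) :=
              add_le_add (by split_ifs <;> simp [ht0]) (mul_le_mul_of_nonneg_right hdw' htB)
          _ = B := hrec
      have hstep := corrSum_insert_le hJ he (ht _) (hnn v) hB hv hw
      have hne : s(v, w) ≠ s(v, l) := fun h => hwl (Sym2.congr_right.1 h)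
      have hd : degAvoid (insert s(v, w) S) l v = degAvoid S l v + 1 := by
        rw [degAvoid, degAvoid, Finset.filter_insert, if_pos ⟨Sym2.mem_mk_left v w, hne⟩,
          Finset.card_insert_of_notMem (by simp [he])]
      have hm : s(v, l) ∈ insert s(v, w) S ↔ s(v, l) ∈ S := by
        rw [Finset.mem_insert, or_iff_right hne.symm]
      rw [hd]
      simp only [hm]
      convert hstep using 2
      push_cast
      ring

end Ising

lemma exp_weightedEnergy {d : ℕ} {J : Fin d → Fin d → ℝ} (hsym : ∀ u v, J u v = J v u)
    (x : Fin d → Bool) :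
    Real.exp (weightedEnergy d J x) =
      gibbsWeight (Sym2.lift ⟨J, hsym⟩)
        (Finset.univ.filter fun e => ¬ e.IsDiag ∧ Sym2.lift ⟨J, hsym⟩ e ≠ 0) x := by
  rw [gibbsWeight, weightedEnergy]
  congr 1
  rw [← Finset.filter_filter, Finset.sum_filter_of_ne fun e _ h => left_ne_zero_of_mul h]
  have h := Finset.sum_sym2_filter_not_isDiag (Finset.univ : Finset (Fin d))
    fun e => Sym2.lift ⟨J, hsym⟩ e * edgeSpin x e
  rw [Finset.sym2_univ] at h
  convert h.symm using 1
  refine Finset.sum_congr ?_ fun p _ => ?_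
  · ext p
    simpa using fun h => ne_of_lt h
  · simp [mul_assoc]

/-- High temperature no-edge correlation upper bound: in a ferromagnet of maximum degree
at most `s` with all interactions in `[0, Θ]` and `(s-1) tanh Θ < 1`, the correlation of
two non-adjacent vertices is at most `s tanh² Θ / (1 - (s-1) tanh Θ)`. -/
theorem no_edge_correlation_high_temp (d s : ℕ) (Θ : ℝ) (hΘ : 0 ≤ Θ)
    (J : Fin d → Fin d → ℝ) (hsym : ∀ u v, J u v = J v u)
    (hJ : ∀ u v, 0 ≤ J u v ∧ J u v ≤ Θ)
    (hdeg : ∀ u : Fin d, (Finset.univ.filter (fun v : Fin d => v ≠ u ∧ J u v ≠ 0)).card ≤ s)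
    (htemp : ((s : ℝ) - 1) * Real.tanh Θ < 1)
    (k ℓ : Fin d) (hkl : k ≠ ℓ) (hnadj : J k ℓ = 0) :
    (∑ x : Fin d → Bool, spin (x k) * spin (x ℓ) * Real.exp (weightedEnergy d J x)) /
      (∑ x : Fin d → Bool, Real.exp (weightedEnergy d J x))
      ≤ (s : ℝ) * Real.tanh Θ ^ 2 / (1 - ((s : ℝ) - 1) * Real.tanh Θ) := by
  set t := Real.tanh Θ
  have ht0 : 0 ≤ t := tanh_nonneg hΘ
  have hden : 0 < 1 - ((s : ℝ) - 1) * t := sub_pos.2 htemp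
  let K : Sym2 (Fin d) → ℝ := Sym2.lift ⟨J, hsym⟩
  let S : Finset (Sym2 (Fin d)) := Finset.univ.filter fun e => ¬ e.IsDiag ∧ K e ≠ 0
  have hK : ∀ e, 0 ≤ K e ∧ K e ≤ Θ := fun e => by
    induction e with
    | _ u v => exact hJ u v
  have hdegS : ∀ v, (S.filter fun e => v ∈ e).card ≤ s := fun v => by
    refine le_trans (le_trans (Finset.card_le_card fun e he => ?_)
      (Finset.card_image_le (f := fun w => s(v, w)))) (hdeg v)
    obtain ⟨he, hv⟩ := Finset.mem_filter.1 he
    obtain ⟨-, hd, hne⟩ := Finset.mem_filter.1 he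
    obtain ⟨w, rfl⟩ := Sym2.mem_iff_exists.1 hv
    rw [Sym2.mk_isDiag_iff] at hd
    exact Finset.mem_image_of_mem _
      (Finset.mem_filter.2 ⟨Finset.mem_univ _, Ne.symm hd, hne⟩)
  have hB : 0 ≤ t / (1 - ((s : ℝ) - 1) * t) := div_nonneg ht0 hden.le
  have hmain := corrSum_le (fun e => (hK e).1) (fun e => tanh_le_tanh (hK e).2) ht0 hB
    (s := s) (by field_simp; ring) S hdegS hkl
  have hkS : s(k, ℓ) ∉ S := fun h => (Finset.mem_filter.1 h).2.2 hnadj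
  have hk : (degAvoid S ℓ k : ℝ) ≤ s := by
    refine Nat.cast_le.2 (le_trans ?_ (hdegS k))
    exact Finset.card_le_card (Finset.monotone_filter_right _ fun _ _ h => h.1)
  simp only [exp_weightedEnergy hsym]
  change corrSum K S k ℓ / partitionSum K S ≤ _
  rw [div_le_iff₀ (partitionSum_pos K S)]
  refine hmain.trans (mul_le_mul_of_nonneg_right ?_ (partitionSum_pos K S).le)
  rw [if_neg hkS, zero_add]
  refine (mul_le_mul_of_nonneg_right hk (mul_nonneg ht0 hB)).trans_eq ?_
  ring
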